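/- Suppose there exist a finite integer N ≥ 1, distinct points X_1, ..., X_N in ℝ³ with 0 < |X_k| < 1 for every k, and nonzero vectors D_1, ..., D_N ∈ ℝ³, such that W(X) = Σ_{k=1}^{N} D_k · ∇_X (1/|X − X_k|) = 0 for every X ∈ ℝ³ with |X| ≥ 1. Then there exist distinct points Y_1, ..., Y_N in ℝ² with 0 < |Y_k| < 1 and nonzero vectors E_1, ..., E_N ∈ ℝ² (the projections of the D_k onto a suitable plane) such that Σ_{k=1}^{N} E_k · ∇_Y ln(1/|Y − Y_k|) = 0 for every Y ∈ ℝ² with |Y| ≥ 1. -/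

import Mathlib

open RealInnerProductSpace

/-- The inverse distance to a point is analytic away from that point. -/
lemma pd_analyticAt (A P : EuclideanSpace ℝ (Fin 3)) (hP : P ≠ A) :
    AnalyticAt ℝ (fun P' : EuclideanSpace ℝ (Fin 3) => 1 / ‖P' - A‖) P := by
  have h1 : ContDiffAt ℝ (⊤ : WithTop ℕ∞) (fun P' : EuclideanSpace ℝ (Fin 3) => 1 / ‖P' - A‖) P := by
    refine ContDiffAt.div contDiffAt_const ?_ (norm_ne_zero_iff.2 (sub_ne_zero.2 hP))
    exact (contDiffAt_id.sub contDiffAt_const).norm ℝ (sub_ne_zero.2 hP)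
  exact h1.analyticAt

/-- The dipole term is a directional derivative. -/
lemma pd_inner (f : EuclideanSpace ℝ (Fin 3) → ℝ) (P D : EuclideanSpace ℝ (Fin 3)) :
    ⟪D, gradient f P⟫ = fderiv ℝ f P D := by
  rw [real_inner_comm, gradient, InnerProductSpace.toDual_symm_apply]

/-- The dipole term is analytic away from the source. -/
lemma pd_term_analyticAt (A D P : EuclideanSpace ℝ (Fin 3)) (hP : P ≠ A) :
    AnalyticAt ℝ (fun P => fderiv ℝ (fun P' : EuclideanSpace ℝ (Fin 3) => 1 / ‖P' - A‖) P D) P := by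
  have h := (pd_analyticAt A P hP).fderiv
  exact ((ContinuousLinearMap.apply ℝ ℝ D).analyticAt _).comp h

/-- Value of the dipole term along the dipole axis. -/
lemma pd_term_axis (A D : EuclideanSpace ℝ (Fin 3)) (hD : D ≠ 0) (t : ℝ) (ht : 0 < t) :
    fderiv ℝ (fun P' : EuclideanSpace ℝ (Fin 3) => 1 / ‖P' - A‖) (A + t • D) D
      = -(1 / (t ^ 2 * ‖D‖)) := by
  have hD' : ‖D‖ ≠ 0 := norm_ne_zero_iff.2 hD
  have hne : A + t • D ≠ A := by
    simp [ht.ne', hD]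
  have h1 := (pd_analyticAt A _ hne).differentiableAt.hasFDerivAt
  have h2 : HasDerivAt (fun s : ℝ => A + s • D) D t := by
    simpa using ((hasDerivAt_id t).smul_const D).const_add A
  have h3 := h1.comp_hasDerivAt t h2
  have h4 : HasDerivAt (fun s : ℝ => s⁻¹ * ‖D‖⁻¹) (-(t ^ 2)⁻¹ * ‖D‖⁻¹) t :=
    (hasDerivAt_inv ht.ne').mul_const _
  have h5 : (fun s : ℝ => s⁻¹ * ‖D‖⁻¹) =ᶠ[nhds t]
      ((fun P' : EuclideanSpace ℝ (Fin 3) => 1 / ‖P' - A‖) ∘ fun s : ℝ => A + s • D) := by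
    filter_upwards [lt_mem_nhds ht] with s hs
    simp [norm_smul, abs_of_pos hs, mul_comm]
  rw [h3.unique (h4.congr_of_eventuallyEq h5.symm)]
  field_simp

/-- No nontrivial finite dipole configuration in the ball has vanishing exterior potential. -/
lemma pd_no_counterexample (N : ℕ) (hN : 1 ≤ N)
    (X : Fin N → EuclideanSpace ℝ (Fin 3)) (hX : Function.Injective X)
    (D : Fin N → EuclideanSpace ℝ (Fin 3)) (hD : ∀ k, D k ≠ 0)
    (hX1 : ∀ k, ‖X k‖ < 1)
    (h : ∀ P : EuclideanSpace ℝ (Fin 3), 1 ≤ ‖P‖ →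
      ∑ k, ⟪D k, gradient (fun P' : EuclideanSpace ℝ (Fin 3) => 1 / ‖P' - X k‖) P⟫ = 0) :
    False := by
  simp only [pd_inner] at h
  set F : Fin N → EuclideanSpace ℝ (Fin 3) → ℝ := fun k P =>
    fderiv ℝ (fun P' : EuclideanSpace ℝ (Fin 3) => 1 / ‖P' - X k‖) P (D k) with hF
  have hFa : ∀ k P, P ≠ X k → AnalyticAt ℝ (F k) P := fun k P hP =>
    pd_term_analyticAt (X k) (D k) P hP
  have han : AnalyticOnNhd ℝ (fun P => ∑ k, F k P) (Set.range X)ᶜ := by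
    intro P hP
    refine Finset.analyticAt_fun_sum _ fun k _ => hFa k P ?_
    rintro rfl
    exact hP ⟨k, rfl⟩
  have hconn : IsPreconnected ((Set.range X)ᶜ) := by
    refine ((Set.finite_range X).countable.isPathConnected_compl_of_one_lt_rank
      ?_).isConnected.isPreconnected
    rw [rank_eq_card_basis (EuclideanSpace.basisFun (Fin 3) ℝ).toBasis]
    norm_num
  obtain ⟨P0, hP0⟩ : ∃ P0 : EuclideanSpace ℝ (Fin 3), ‖P0‖ = 2 :=
    ⟨EuclideanSpace.single 0 2, by simp⟩
  have hP0' : P0 ∈ (Set.range X)ᶜ := by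
    rintro ⟨k, rfl⟩
    linarith [hX1 k]
  have hev : (fun P => ∑ k, F k P) =ᶠ[nhds P0] 0 := by
    have : ∀ᶠ P in nhds P0, 1 < ‖P‖ :=
      continuous_norm.continuousAt.eventually (lt_mem_nhds (by simp only [hP0]; norm_num))
    filter_upwards [this] with P hP
    exact h P hP.le
  have hzero := han.eqOn_zero_of_preconnected_of_eventuallyEq_zero hconn hP0' hev
  let k0 : Fin N := ⟨0, hN⟩
  have hline : Filter.Tendsto (fun t : ℝ => X k0 + t • D k0) (nhdsWithin 0 (Set.Ioi 0))
      (nhds (X k0)) := by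
    have hc : Continuous (fun t : ℝ => X k0 + t • D k0) := by fun_prop
    have := hc.tendsto 0
    simp only [zero_smul, add_zero] at this
    exact this.mono_left nhdsWithin_le_nhds
  have hsq : Filter.Tendsto (fun t : ℝ => t ^ 2) (nhdsWithin 0 (Set.Ioi 0)) (nhds 0) := by
    have hc : Continuous (fun t : ℝ => t ^ 2) := by fun_prop
    have := hc.tendsto 0
    simp only [ne_eq, OfNat.ofNat_ne_zero, not_false_eq_true, zero_pow] at this
    exact this.mono_left nhdsWithin_le_nhds
  have hrest : Filter.Tendsto (fun P => ∑ k ∈ Finset.univ.erase k0, F k P) (nhds (X k0))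
      (nhds (∑ k ∈ Finset.univ.erase k0, F k (X k0))) := by
    refine tendsto_finsetSum _ fun k hk => (hFa k _ ?_).continuousAt
    exact fun e => (Finset.ne_of_mem_erase hk) (hX e).symm
  have hlim := hsq.mul (hrest.comp hline)
  rw [zero_mul] at hlim
  have hconst : ∀ᶠ t : ℝ in nhdsWithin 0 (Set.Ioi 0),
      t ^ 2 * ((fun P => ∑ k ∈ Finset.univ.erase k0, F k P) ∘ fun t : ℝ => X k0 + t • D k0) t
        = 1 / ‖D k0‖ := by
    have hfin : ∀ᶠ P in nhds (X k0), ∀ k ∈ Finset.univ.erase k0, P ≠ X k := by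
      rw [Filter.eventually_all_finset]
      intro k hk
      exact isOpen_ne.mem_nhds fun e => (Finset.ne_of_mem_erase hk) (hX e).symm
    filter_upwards [hline.eventually hfin, self_mem_nhdsWithin] with t ht htpos
    have htpos : 0 < t := htpos
    have hmem : X k0 + t • D k0 ∈ (Set.range X)ᶜ := by
      rintro ⟨k, hk⟩
      by_cases hkk : k = k0
      · subst hkk
        have : t • D k0 = 0 := by simpa using hk.symm
        exact (smul_ne_zero htpos.ne' (hD _)) this
      · exact ht k (by simp [hkk]) hk.symm
    have hz : ∑ k, F k (X k0 + t • D k0) = 0 := hzero hmem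
    rw [← Finset.add_sum_erase _ _ (Finset.mem_univ k0)] at hz
    have hax : F k0 (X k0 + t • D k0) = -(1 / (t ^ 2 * ‖D k0‖)) :=
      pd_term_axis (X k0) (D k0) (hD k0) t htpos
    have hs : ∑ k ∈ Finset.univ.erase k0, F k (X k0 + t • D k0) = 1 / (t ^ 2 * ‖D k0‖) := by
      linarith
    have hD' : ‖D k0‖ ≠ 0 := norm_ne_zero_iff.2 (hD k0)
    simp only [Function.comp]
    rw [hs]
    field_simp
  have hlim2 := (Filter.tendsto_congr' hconst).1 hlim
  have := tendsto_nhds_unique hlim2 tendsto_const_nhds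
  exact one_div_ne_zero (norm_ne_zero_iff.2 (hD k0)) this.symm

/-- If a point-dipole uniqueness counterexample exists in `ℝ³` (nonzero dipole vectors
at distinct points of the punctured open unit ball whose potential
`W(X) = Σ D_k · ∇(1/‖X - X_k‖)` vanishes on `‖X‖ ≥ 1`), then one exists in `ℝ²`. -/
theorem point_dipole_counterexample_R3_to_R2 (N : ℕ) (hN : 1 ≤ N)
    (X : Fin N → EuclideanSpace ℝ (Fin 3)) (hX : Function.Injective X)
    (hX1 : ∀ k, 0 < ‖X k‖ ∧ ‖X k‖ < 1)
    (D : Fin N → EuclideanSpace ℝ (Fin 3)) (hD : ∀ k, D k ≠ 0)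
    (h : ∀ P : EuclideanSpace ℝ (Fin 3), 1 ≤ ‖P‖ →
      ∑ k, ⟪D k, gradient (fun P' : EuclideanSpace ℝ (Fin 3) => 1 / ‖P' - X k‖) P⟫ = 0) :
    ∃ (Y : Fin N → EuclideanSpace ℝ (Fin 2)) (E : Fin N → EuclideanSpace ℝ (Fin 2)),
      Function.Injective Y ∧ (∀ k, 0 < ‖Y k‖ ∧ ‖Y k‖ < 1) ∧ (∀ k, E k ≠ 0) ∧
      ∀ Q : EuclideanSpace ℝ (Fin 2), 1 ≤ ‖Q‖ →
        ∑ k, ⟪E k, gradient (fun Q' : EuclideanSpace ℝ (Fin 2) =>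
          Real.log (1 / ‖Q' - Y k‖)) Q⟫ = 0 := by
  exact (pd_no_counterexample N hN X hX D hD (fun k => (hX1 k).2) h).elim
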